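/- Let (X,d) be a pseudo-quasi-metric space with the midpoint property, let π : X × X → X be uniformly continuous, and let V : X × X → ℝ satisfy (i) V(x,y) = V(x,π(x,y)) + V(π(x,y),y) for all x,y; (ii) V(x,π(x,y))² + V(π(x,y),y)² ≤ V(x,z)² + V(z,y)² for all x,y,z; (iii) d(x,π(x,x)) = d(π(x,x),x) = 0 for all x. Then there exists ε₀ > 0 such that for every ε with 0 < ε < ε₀ the following holds: if there exists δ > 0 such that (1−ε)·d(x,y) ≤ V(x,y) ≤ (1+ε)·d(x,y) whenever d(x,y) < δ, then (1−ε)·d(x,y) ≤ V(x,y) ≤ (1+ε)·d(x,y) for all x,y ∈ X. -/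

import Mathlib

theorem exists_near_right {X : Type*} (d : X → X → ℝ)
    (hd_tri : ∀ x y z, d x z ≤ d x y + d y z)
    (hmid : ∀ x y, ∃ z, d x z = d x y / 2 ∧ d z y = d x y / 2) (β : ℝ) (n : ℕ) :
    ∀ x y, β ≤ d x y → d x y < 2 ^ n * β → ∃ z, d z y < β ∧ d x z ≤ d x y - β / 2 := by
  induction n with
  | zero => intro x y h1 h2; simp at h2; linarith
  | succ n ih =>
    intro x y h1 h2
    obtain ⟨z, hz1, hz2⟩ := hmid x y
    by_cases h : d x y / 2 < β
    · exact ⟨z, by linarith, by linarith⟩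
    · rw [pow_succ] at h2
      obtain ⟨w, hw1, hw2⟩ := ih z y (by linarith) (by linarith)
      exact ⟨w, hw1, by linarith [hd_tri x z w]⟩

theorem exists_near_right' {X : Type*} (d : X → X → ℝ)
    (hd_tri : ∀ x y z, d x z ≤ d x y + d y z)
    (hmid : ∀ x y, ∃ z, d x z = d x y / 2 ∧ d z y = d x y / 2) (β : ℝ) (hβ : 0 < β)
    (x y : X) (h : β ≤ d x y) : ∃ z, d z y < β ∧ d x z ≤ d x y - β / 2 := by
  obtain ⟨n, hn⟩ := pow_unbounded_of_one_lt (d x y / β) (one_lt_two)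
  exact exists_near_right d hd_tri hmid β n x y h ((div_lt_iff₀ hβ).1 hn)

/-- Proposition 1 (first part): for sufficiently small ε, if `V` approximates `d` within a factor
`1 ± ε` for close pairs of points, then it does so globally. -/
theorem midpoint_actor_critic_local_to_global {X : Type*}
    (d : X → X → ℝ) (π : X → X → X) (V : X → X → ℝ)
    (hd_refl : ∀ x, d x x = 0)
    (hd_nonneg : ∀ x y, 0 ≤ d x y)
    (hd_tri : ∀ x y z, d x z ≤ d x y + d y z)
    (hmid : ∀ x y, ∃ z, d x z = d x y / 2 ∧ d z y = d x y / 2)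
    (hπ_uc : ∀ α > (0 : ℝ), ∃ β > (0 : ℝ), ∀ x y z, d y z < β →
      d (π x y) (π x z) < α ∧ d (π y x) (π z x) < α)
    (hV_split : ∀ x y, V x y = V x (π x y) + V (π x y) y)
    (hV_min : ∀ x y z, V x (π x y) ^ 2 + V (π x y) y ^ 2 ≤ V x z ^ 2 + V z y ^ 2)
    (hπ_diag : ∀ x, d x (π x x) = 0 ∧ d (π x x) x = 0) :
    ∃ ε₀ > (0 : ℝ), ∀ ε : ℝ, 0 < ε → ε < ε₀ →
      (∃ δ > (0 : ℝ), ∀ x y, d x y < δ →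
        (1 - ε) * d x y ≤ V x y ∧ V x y ≤ (1 + ε) * d x y) →
      ∀ x y, (1 - ε) * d x y ≤ V x y ∧ V x y ≤ (1 + ε) * d x y := by
  refine ⟨1 / 20, by norm_num, ?_⟩
  rintro ε hε hε' ⟨δ, hδ, hloc⟩
  have U : ∀ n : ℕ, ∀ x y, d x y < 2 ^ n * δ → V x y ^ 2 ≤ ((1 + ε) * d x y) ^ 2 := by
    intro n
    induction n with
    | zero =>
      intro x y h
      obtain ⟨h1, h2⟩ := hloc x y (by simpa using h)
      have h0 : 0 ≤ (1 - ε) * d x y := mul_nonneg (by linarith) (hd_nonneg x y)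
      exact pow_le_pow_left₀ (by linarith) h2 2
    | succ n ih =>
      intro x y h
      rw [pow_succ] at h
      obtain ⟨z, hz1, hz2⟩ := hmid x y
      have a := ih x z (by linarith)
      have b := ih z y (by linarith)
      rw [hz1] at a
      rw [hz2] at b
      have c := hV_min x y z
      rw [hV_split x y]
      nlinarith [sq_nonneg (V x (π x y) - V (π x y) y)]
  have Ug : ∀ x y, V x y ^ 2 ≤ ((1 + ε) * d x y) ^ 2 := by
    intro x y
    obtain ⟨n, hn⟩ := pow_unbounded_of_one_lt (d x y / δ) (one_lt_two)
    exact U n x y ((div_lt_iff₀ hδ).1 hn)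
  have pos : ∀ x y, 0 ≤ (1 + ε) * d x y := fun x y =>
    mul_nonneg (by linarith) (hd_nonneg x y)
  have hM : ∀ x y, V x (π x y) ^ 2 + V (π x y) y ^ 2 ≤ ((1 + ε) * d x y) ^ 2 / 2 := by
    intro x y
    obtain ⟨z, hz1, hz2⟩ := hmid x y
    have a := Ug x z
    have b := Ug z y
    rw [hz1] at a
    rw [hz2] at b
    have c := hV_min x y z
    nlinarith
  have key : ∀ t v D : ℝ, 0 ≤ t → 0 ≤ D → (1 - ε) * t ≤ v → v ^ 2 ≤ ((1 + ε) * D) ^ 2 / 2 →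
      t ≤ 4 / 5 * D := by
    intro t v D ht hD h1 h2
    have e1 : 19 / 20 * t ≤ v := by nlinarith
    have e2 : (1 + ε) * D ≤ 21 / 20 * D := by nlinarith
    have e3 : ((1 + ε) * D) ^ 2 ≤ (21 / 20 * D) ^ 2 :=
      pow_le_pow_left₀ (mul_nonneg (by linarith) hD) e2 2
    have e4 : (19 / 20 * t) ^ 2 ≤ v ^ 2 := pow_le_pow_left₀ (by linarith) e1 2
    refine (abs_le_of_sq_le_sq' (b := 4 / 5 * D) ?_ (by linarith)).2
    nlinarith [sq_nonneg D]
  obtain ⟨β, hβ, huc⟩ := hπ_uc (δ / 10) (by linarith)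
  have L : ∀ n : ℕ, ∀ x y, d x y < n * (β / 2) → (1 - ε) * d x y ≤ V x y ∧
      d x (π x y) ≤ 4 / 5 * d x y ∧ d (π x y) y ≤ 4 / 5 * d x y := by
    intro n
    induction n with
    | zero => intro x y h; simp at h; linarith [hd_nonneg x y]
    | succ n ih =>
      intro x y h
      push_cast at h
      have low : ∀ a b, (d a b < n * (β / 2) ∨ d a b < δ) → (1 - ε) * d a b ≤ V a b := by
        rintro a b (h | h)
        · exact (ih a b h).1
        · exact (hloc a b h).1
      have bd : (d x (π x y) < n * (β / 2) ∨ d x (π x y) < δ) ∧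
          (d (π x y) y < n * (β / 2) ∨ d (π x y) y < δ) := by
        by_cases hb : d x y < β
        · have h1 := (huc x x y hb).1
          have h2 := (huc y x y hb).2
          have h3 := hd_tri x (π x x) (π x y)
          have h4 := hd_tri (π x y) (π y y) y
          have h5 := (hπ_diag x).1
          have h6 := (hπ_diag y).2
          exact ⟨Or.inr (by linarith), Or.inr (by linarith)⟩
        · push Not at hb
          obtain ⟨z, hz1, hz2⟩ := exists_near_right' d hd_tri hmid β hβ x y hb
          obtain ⟨w, hw1, hw2⟩ := exists_near_right' (fun a b => d b a)
            (fun a b c => by linarith [hd_tri c b a])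
            (fun a b => by obtain ⟨z, h1, h2⟩ := hmid b a; exact ⟨z, h2, h1⟩) β hβ y x hb
          have a1 := (ih x z (by linarith)).2.1
          have a2 := (ih w y (by linarith)).2.2
          have b1 := (huc x z y hz1).1
          have b2 := (huc y x w hw1).2
          have c1 := hd_tri x (π x z) (π x y)
          have c2 := hd_tri (π x y) (π w y) y
          constructor
          · by_contra hc
            push Not at hc
            linarith [hc.1, hc.2]
          · by_contra hc
            push Not at hc
            linarith [hc.1, hc.2]
      have l1 := low _ _ bd.1
      have l2 := low _ _ bd.2
      have m := hM x y
      refine ⟨?_, key _ _ _ (hd_nonneg _ _) (hd_nonneg _ _) l1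
        (by linarith [sq_nonneg (V (π x y) y)]), key _ _ _ (hd_nonneg _ _) (hd_nonneg _ _) l2
        (by linarith [sq_nonneg (V x (π x y))])⟩
      have t := mul_le_mul_of_nonneg_left (hd_tri x (π x y) y) (by linarith : 0 ≤ 1 - ε)
      rw [hV_split x y]
      linarith
  intro x y
  refine ⟨?_, (abs_le_of_sq_le_sq' (Ug x y) (pos x y)).2⟩
  obtain ⟨n, hn⟩ := exists_nat_gt (d x y / (β / 2))
  exact (L n x y ((div_lt_iff₀ (by linarith)).1 hn)).1
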